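/- arXiv:2406.17203 — 8 statements merged into one kernel-verified Lean document; each statement's English description precedes it below -/
import Mathlib

section
/- Let L be a real-linear subspace of ℂⁿ with dim_ℝ L = n and L ∩ iL = {0} (L contains no nonzero complex subspace). Let L^⊥ = {w ∈ ℂⁿ : Re⟨z, w⟩ = 0 for all z ∈ L}, let λ₁, …, λₙ be an ℝ-basis of L^⊥, and let a₁, …, aₙ ∈ ℂ∖{0}. Then the set Y = {z ∈ ℂⁿ : e^{⟨z, λⱼ⟩} = aⱼ for j = 1, …, n} is nonempty, and for every y ∈ Y one has Y = y + S, where S = {z ∈ ℂⁿ : ⟨z, λⱼ⟩ ∈ 2πiℤ for all j}. Moreover S is contained in L, S is a free abelian group of rank n, and the ℝ-linear span of S is L. -/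
theorem aux_mem (n : ℕ) (L : Submodule ℝ (EuclideanSpace ℂ (Fin n)))
    (lam : Fin n → EuclideanSpace ℂ (Fin n))
    (hspan : ∀ w : EuclideanSpace ℂ (Fin n),
      (∀ z ∈ L, (inner ℂ z w : ℂ).re = 0) → w ∈ Submodule.span ℝ (Set.range lam))
    (z : EuclideanSpace ℂ (Fin n)) (hz : ∀ j, (inner ℂ (lam j) z : ℂ).re = 0) : z ∈ L := by
  letI : InnerProductSpace ℝ (EuclideanSpace ℂ (Fin n)) := InnerProductSpace.complexToReal
  have h : z ∈ Lᗮᗮ := by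
    rw [Submodule.mem_orthogonal]
    intro u hu
    rw [Submodule.mem_orthogonal] at hu
    have hu' := hspan u hu
    change (inner ℂ u z : ℂ).re = 0
    clear hu
    induction hu' using Submodule.span_induction with
    | mem x hx => obtain ⟨j, rfl⟩ := hx; exact hz j
    | zero => simp
    | add x y _ _ hx hy => rw [inner_add_left, Complex.add_re, hx, hy, add_zero]
    | smul c x _ hx =>
      rw [← Complex.coe_smul, inner_smul_left, Complex.conj_ofReal, Complex.re_ofReal_mul, hx,
        mul_zero]
  rwa [Submodule.orthogonal_orthogonal] at h


/-- structural part of Proposition 7.3. Let `L ⊆ ℂⁿ` be a real subspace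
with `dim_ℝ L = n` containing no nonzero complex subspace, let `λ₁, …, λₙ` be an ℝ-basis of
`L^⊥ = {w : Re⟨z,w⟩ = 0 ∀ z ∈ L}`, and let `a₁, …, aₙ ∈ ℂ∖{0}`. Then the solution set
`Y = {z : e^{⟨z,λⱼ⟩} = aⱼ ∀ j}` is nonempty and is a translate `y + S` of
`S = {z : ⟨z,λⱼ⟩ ∈ 2πiℤ ∀ j}`; moreover `S ⊆ L`, `S` is free abelian of rank `n`,
and the ℝ-linear span of `S` is `L`. (Here `⟨·,·⟩` is the Hermitian inner product,
linear in its left argument, rendered below as `inner (λ j) z`.) -/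
theorem solution_set_is_translate_of_lattice
    (n : ℕ) (L : Submodule ℝ (EuclideanSpace ℂ (Fin n)))
    (hdim : Module.finrank ℝ L = n)
    (hnoC : ∀ z ∈ L, Complex.I • z ∈ L → z = 0)
    (lam : Fin n → EuclideanSpace ℂ (Fin n))
    (hmem : ∀ j, ∀ z ∈ L, (inner ℂ z (lam j) : ℂ).re = 0)
    (hli : LinearIndependent ℝ lam)
    (hspan : ∀ w : EuclideanSpace ℂ (Fin n),
      (∀ z ∈ L, (inner ℂ z w : ℂ).re = 0) → w ∈ Submodule.span ℝ (Set.range lam))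
    (a : Fin n → ℂ) (ha : ∀ j, a j ≠ 0) :
    let Y : Set (EuclideanSpace ℂ (Fin n)) :=
      {z | ∀ j, Complex.exp (inner ℂ (lam j) z : ℂ) = a j}
    let S : Set (EuclideanSpace ℂ (Fin n)) :=
      {z | ∀ j, ∃ m : ℤ, (inner ℂ (lam j) z : ℂ) = 2 * (Real.pi : ℂ) * Complex.I * (m : ℂ)}
    Y.Nonempty ∧
    (∀ y ∈ Y, Y = (fun s => y + s) '' S) ∧
    S ⊆ (L : Set (EuclideanSpace ℂ (Fin n))) ∧
    (∃ b : Fin n → EuclideanSpace ℂ (Fin n),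
      (∀ j, b j ∈ S) ∧ LinearIndependent ℝ b ∧
      (∀ s ∈ S, ∃ m : Fin n → ℤ, s = ∑ j, (m j) • b j) ∧
      Submodule.span ℝ S = L) := by
  intro Y S
  have key : ∀ z : EuclideanSpace ℂ (Fin n), (∀ j, (inner ℂ (lam j) z : ℂ).re = 0) → z ∈ L :=
    aux_mem n L lam hspan
  let φ : EuclideanSpace ℂ (Fin n) →ₗ[ℂ] (Fin n → ℂ) :=
    { toFun := fun z j => inner ℂ (lam j) z
      map_add' := fun x y => by funext j; simp [inner_add_right]
      map_smul' := fun c x => by funext j; simp [inner_smul_right] }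
  have φa : ∀ z j, φ z j = inner ℂ (lam j) z := fun _ _ => rfl
  have hinj : Function.Injective φ := by
    rw [← LinearMap.ker_eq_bot, LinearMap.ker_eq_bot']
    intro z hz
    have h0 : ∀ j, inner ℂ (lam j) z = (0 : ℂ) := fun j => by rw [← φa, hz]; rfl
    refine hnoC z (key z fun j => by rw [h0 j]; rfl) (key _ fun j => ?_)
    rw [inner_smul_right, h0 j]; simp
  have hsurj : Function.Surjective φ :=
    (LinearMap.injective_iff_surjective_of_finrank_eq_finrank (by simp)).1 hinj
  have hpi : (2 * (Real.pi : ℂ) * Complex.I) ≠ 0 := Complex.two_pi_I_ne_zero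
  have hSL : S ⊆ (L : Set (EuclideanSpace ℂ (Fin n))) := by
    intro z hz
    refine key z fun j => ?_
    obtain ⟨m, hm⟩ := hz j
    rw [hm]; simp
  refine ⟨?_, ?_, hSL, ?_⟩
  · obtain ⟨z, hz⟩ := hsurj fun j => Complex.log (a j)
    refine ⟨z, fun j => ?_⟩
    rw [← φa, hz, Complex.exp_log (ha j)]
  · intro y hy
    ext z
    constructor
    · intro hz
      refine ⟨z - y, fun j => ?_, by simp⟩
      have h := (hz j).trans (hy j).symm
      obtain ⟨m, hm⟩ := Complex.exp_eq_exp_iff_exists_int.1 h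
      refine ⟨m, ?_⟩
      rw [inner_sub_right, hm]; ring
    · rintro ⟨s, hs, rfl⟩ j
      obtain ⟨m, hm⟩ := hs j
      rw [← hy j]
      refine Complex.exp_eq_exp_iff_exists_int.2 ⟨m, ?_⟩
      simp only [inner_add_right]
      rw [hm]; ring
  · choose b hb using fun j : Fin n =>
      hsurj (Pi.single j (2 * (Real.pi : ℂ) * Complex.I))
    have hbS : ∀ j, b j ∈ S := by
      intro j k
      rw [← φa, hb]
      by_cases h : k = j
      · subst h; exact ⟨1, by simp⟩
      · exact ⟨0, by simp [h]⟩
    have hsum : ∀ (g : Fin n → ℂ) k, φ (∑ j, g j • b j) k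
        = g k * (2 * (Real.pi : ℂ) * Complex.I) := by
      intro g k
      rw [map_sum, Finset.sum_apply, Finset.sum_eq_single k]
      · rw [map_smul, hb]; simp
      · intro j _ hj
        rw [map_smul, hb]; simp [hj.symm]
      · simp
    have hbli : LinearIndependent ℝ b := by
      rw [Fintype.linearIndependent_iff]
      intro g hg k
      have h := hsum (fun j => (g j : ℂ)) k
      simp only [Complex.coe_smul] at h
      rw [hg] at h
      have h2 : (g k : ℂ) * (2 * (Real.pi : ℂ) * Complex.I) = 0 := by rw [← h]; simp
      exact_mod_cast (mul_eq_zero.1 h2).resolve_right hpi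
    refine ⟨b, hbS, hbli, ?_, ?_⟩
    · intro s hs
      choose m hm using hs
      refine ⟨m, hinj ?_⟩
      funext k
      have h := hsum (fun j => (m j : ℂ)) k
      simp only [Int.cast_smul_eq_zsmul] at h
      rw [h, φa, hm]; ring
    · have hle : Submodule.span ℝ S ≤ L := Submodule.span_le.2 hSL
      refine Submodule.eq_of_le_of_finrank_le hle ?_
      have h1 : Submodule.span ℝ (Set.range b) ≤ Submodule.span ℝ S :=
        Submodule.span_mono (by rintro _ ⟨j, rfl⟩; exact hbS j)
      have h2 := Submodule.finrank_mono h1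
      rw [finrank_span_eq_card hbli, Fintype.card_fin] at h2
      rw [hdim]; exact h2
end

section
/- Let L be a real-linear subspace of ℂⁿ with dim_ℝ L = n and L ∩ iL = {0}, let L^⊥ = {w ∈ ℂⁿ : Re⟨z, w⟩ = 0 for all z ∈ L}, and let λ₁, …, λₙ be an ℝ-basis of L^⊥. Then there exists an ℝ-basis μ₁, …, μₙ of L such that ⟨μ_q, λ_p⟩ = i·δ_{pq} for all p, q (δ the Kronecker delta). Equivalently, the real bilinear pairing (z, w) ↦ Im⟨z, w⟩ between L and L^⊥ is nondegenerate. -/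
theorem aux_double_orth (n : ℕ) (L : Submodule ℝ (EuclideanSpace ℂ (Fin n)))
    (x : EuclideanSpace ℂ (Fin n))
    (hx : ∀ w : EuclideanSpace ℂ (Fin n),
      (∀ z ∈ L, (inner ℂ z w : ℂ).re = 0) → (inner ℂ w x : ℂ).re = 0) : x ∈ L := by
  letI : InnerProductSpace ℝ (EuclideanSpace ℂ (Fin n)) := InnerProductSpace.complexToReal
  haveI : FiniteDimensional ℝ (EuclideanSpace ℂ (Fin n)) :=
    FiniteDimensional.complexToReal _
  have h := Submodule.orthogonal_orthogonal (𝕜 := ℝ) L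
  rw [← h, Submodule.mem_orthogonal]
  intro w hw
  rw [Submodule.mem_orthogonal] at hw
  exact hx w (fun z hz => hw z hz)


/-- key claim in the proof of Proposition 7.3. Let `L ⊆ ℂⁿ` be a real
subspace with `dim_ℝ L = n` containing no nonzero complex subspace, and `λ₁, …, λₙ` an
ℝ-basis of `L^⊥ = {w : Re⟨z,w⟩ = 0 ∀ z ∈ L}`. Then there is an ℝ-basis `μ₁, …, μₙ` of `L`
with `⟨μ_q, λ_p⟩ = i·δ_{pq}` (inner product linear in its left argument, rendered as
`inner (lam p) (μ q)`); equivalently the pairing `(z, w) ↦ Im⟨z, w⟩` between `L` and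
`L^⊥` is nondegenerate. -/
theorem exists_dual_basis_with_inner_eq_I
    (n : ℕ) (L : Submodule ℝ (EuclideanSpace ℂ (Fin n)))
    (hdim : Module.finrank ℝ L = n)
    (hnoC : ∀ z ∈ L, Complex.I • z ∈ L → z = 0)
    (lam : Fin n → EuclideanSpace ℂ (Fin n))
    (hmem : ∀ j, ∀ z ∈ L, (inner ℂ z (lam j) : ℂ).re = 0)
    (hli : LinearIndependent ℝ lam)
    (hspan : ∀ w : EuclideanSpace ℂ (Fin n),
      (∀ z ∈ L, (inner ℂ z w : ℂ).re = 0) → w ∈ Submodule.span ℝ (Set.range lam)) :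
    (∃ μ : Fin n → EuclideanSpace ℂ (Fin n),
      (∀ q, μ q ∈ L) ∧ LinearIndependent ℝ μ ∧
      Submodule.span ℝ (Set.range μ) = L ∧
      ∀ p q, (inner ℂ (lam p) (μ q) : ℂ) = if p = q then Complex.I else 0) ∧
    (∀ z ∈ L, z ≠ 0 →
      ∃ w : EuclideanSpace ℂ (Fin n),
        (∀ z' ∈ L, (inner ℂ z' w : ℂ).re = 0) ∧ (inner ℂ w z : ℂ).im ≠ 0) := by
  have hre : ∀ j, ∀ z ∈ L, (inner ℂ (lam j) z : ℂ).re = 0 := by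
    intro j z hz
    rw [← inner_conj_symm, Complex.conj_re]
    exact hmem j z hz
  haveI : FiniteDimensional ℝ (EuclideanSpace ℂ (Fin n)) :=
    FiniteDimensional.complexToReal _
  have key : ∀ z ∈ L, (∀ p, (inner ℂ (lam p) z : ℂ).im = 0) → z = 0 := by
    intro z hz h
    refine hnoC z hz (aux_double_orth n L _ ?_)
    intro w hw
    have hw' := hspan w hw
    suffices (inner ℂ w z : ℂ).im = 0 by
      rw [inner_smul_right]; simp [this]
    clear hw
    induction hw' using Submodule.span_induction with
    | mem x hx => obtain ⟨p, rfl⟩ := hx; exact h p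
    | zero => simp
    | add x y hx hy h1 h2 =>
      rw [inner_add_left, Complex.add_im, h1, h2, add_zero]
    | smul a x hx h1 => 
      rw [inner_smul_left_eq_smul, Complex.smul_im, h1, smul_zero]
  let T : L →ₗ[ℝ] (Fin n → ℝ) :=
    { toFun := fun z p => (inner ℂ (lam p) (z : EuclideanSpace ℂ (Fin n)) : ℂ).im
      map_add' := by intro x y; ext p; simp [inner_add_right]
      map_smul' := by
        intro a x; ext p
        simp [inner_smul_right_eq_smul] }
  have hT : Function.Injective T := by
    rw [injective_iff_map_eq_zero]
    intro z hz
    exact Subtype.ext (key z z.2 (fun p => congrFun hz p))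
  let e := LinearEquiv.ofInjectiveOfFinrankEq T hT (by simp [hdim])
  have he : ∀ z, e z = T z := fun z => rfl
  let b : Module.Basis (Fin n) ℝ L := Module.Basis.ofEquivFun e
  have hb : ∀ p q, (inner ℂ (lam p) (b q : EuclideanSpace ℂ (Fin n)) : ℂ).im
      = if p = q then 1 else 0 := by
    intro p q
    have h1 : T (b q) = Pi.single q 1 := by
      rw [← he]; simp [b]
    have := congrFun h1 p
    rw [Pi.single_apply] at this
    exact this
  refine ⟨⟨fun q => (b q : EuclideanSpace ℂ (Fin n)), fun q => (b q).2, ?_, ?_, ?_⟩, ?_⟩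
  · exact b.linearIndependent.map' L.subtype (Submodule.ker_subtype L)
  · have h := congrArg (Submodule.map L.subtype) b.span_eq
    rw [Submodule.map_span, ← Set.range_comp, Submodule.map_subtype_top] at h
    exact h
  · intro p q
    apply Complex.ext
    · rw [hre p _ (b q).2]; split_ifs <;> simp
    · rw [hb]; split_ifs <;> simp
  · intro z hz hz0
    by_contra! hc
    exact hz0 (key z hz fun p => hc (lam p) (hmem p))
end

section
/- Let C be a 2n-dimensional real inner product space and let A and B be n-dimensional subspaces of C such that the pairing (a, b) ↦ ⟨a, b⟩ between A and B is nondegenerate. Let a₁, …, aₙ be a basis of A and b₁, …, bₙ a basis of B that are mutually dual, i.e. ⟨aᵢ, bⱼ⟩ = δᵢⱼ, and let P : C → C be the orthogonal projection onto B. Then det(⟨P aᵢ, P aⱼ⟩)_{i,j} · det(⟨bᵢ, bⱼ⟩)_{i,j} = 1; equivalently, the n-dimensional volumes of the parallelepipeds spanned by P a₁, …, P aₙ and by b₁, …, bₙ multiply to 1. (This is Lemma 7.4 of the paper, with cos(A, B) interpreted as the volume-distortion coefficient of the orthogonal projection A → B.) -/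
/-- Lemma 7.4. Let `C` be a `2n`-dimensional real inner product space,
`A, B ⊆ C` two `n`-dimensional subspaces with nondegenerate pairing `(a,b) ↦ ⟨a,b⟩`,
`a₁,…,aₙ` and `b₁,…,bₙ` mutually dual bases of `A` and `B`, and `P` the orthogonal
projection onto `B`. Then `det(⟨Paᵢ, Paⱼ⟩) · det(⟨bᵢ, bⱼ⟩) = 1` (the squared volumes of
the parallelepipeds spanned by `Pa₁,…,Paₙ` and `b₁,…,bₙ` multiply to `1`). -/
theorem gram_det_proj_mul_gram_det_eq_one
    {C : Type*} [NormedAddCommGroup C] [InnerProductSpace ℝ C] [FiniteDimensional ℝ C]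
    (n : ℕ) (hdim : Module.finrank ℝ C = 2 * n)
    (A B : Submodule ℝ C)
    (hA : Module.finrank ℝ A = n) (hB : Module.finrank ℝ B = n)
    (hnd : ∀ a ∈ A, (∀ b ∈ B, (inner ℝ a b : ℝ) = 0) → a = 0)
    (hnd' : ∀ b ∈ B, (∀ a ∈ A, (inner ℝ a b : ℝ) = 0) → b = 0)
    (a b : Fin n → C)
    (haA : ∀ i, a i ∈ A) (hbB : ∀ i, b i ∈ B)
    (haLI : LinearIndependent ℝ a) (haSpan : Submodule.span ℝ (Set.range a) = A)
    (hbLI : LinearIndependent ℝ b) (hbSpan : Submodule.span ℝ (Set.range b) = B)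
    (hdual : ∀ i j, (inner ℝ (a i) (b j) : ℝ) = if i = j then (1 : ℝ) else 0) :
    Matrix.det (Matrix.of fun i j : Fin n =>
        (inner ℝ ((Submodule.orthogonalProjectionOnto B (a i) : C)) ((Submodule.orthogonalProjectionOnto B (a j) : C)) : ℝ)) *
      Matrix.det (Matrix.of fun i j : Fin n => (inner ℝ (b i) (b j) : ℝ)) = 1 := by
  have hP : ∀ i j, (inner ℝ ((Submodule.orthogonalProjectionOnto B (a i) : C)) (b j) : ℝ)
      = if i = j then (1 : ℝ) else 0 := by
    intro i j
    rw [← hdual i j]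
    have h := Submodule.inner_orthogonalProjectionOnto_eq_of_mem_left (K := B) ⟨b j, hbB j⟩ (a i)
    rw [real_inner_comm, real_inner_comm (b j) (a i)]
    exact h
  have hex : ∀ i, ∃ c : Fin n → ℝ,
      ∑ k, c k • b k = (Submodule.orthogonalProjectionOnto B (a i) : C) := by
    intro i
    have h : (Submodule.orthogonalProjectionOnto B (a i) : C) ∈
        Submodule.span ℝ (Set.range b) := by
      rw [hbSpan]; exact Subtype.property _
    exact (Submodule.mem_span_range_iff_exists_fun ℝ).1 h
  choose M hM using hex
  have h1 : (Matrix.of fun i j : Fin n =>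
        (inner ℝ ((Submodule.orthogonalProjectionOnto B (a i) : C))
          ((Submodule.orthogonalProjectionOnto B (a j) : C)) : ℝ))
      = (Matrix.of M).transpose := by
    ext i j
    simp only [Matrix.of_apply, Matrix.transpose_apply]
    rw [← hM j, inner_sum]
    simp only [inner_smul_right, hP]
    simp
  have h2 : Matrix.of M * (Matrix.of fun i j : Fin n => (inner ℝ (b i) (b j) : ℝ)) = 1 := by
    ext i j
    rw [Matrix.mul_apply, Matrix.one_apply, ← hP i j, ← hM i, sum_inner]
    simp [inner_smul_left]
  rw [h1, Matrix.det_transpose, ← Matrix.det_mul, h2, Matrix.det_one]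
end

section
/- Let E be a real normed vector space, let A and B be nonempty compact subsets of E, and let f : E → ℝ be a continuous linear functional. Then the set of maximizers of f on the Minkowski sum A + B equals the Minkowski sum of the set of maximizers of f on A and the set of maximizers of f on B: {x ∈ A + B : f(x) = sup_{A+B} f} = {a ∈ A : f(a) = sup_A f} + {b ∈ B : f(b) = sup_B f}. -/
open Pointwise

/-- For nonempty compact subsets `A, B` of a real normed space and a
continuous linear functional `f`, the set of maximizers of `f` on the Minkowski sum
`A + B` is the Minkowski sum of the sets of maximizers of `f` on `A` and on `B`
(additivity of the face map, underlying Lemma 3.16). -/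
theorem maximizers_minkowski_sum
    {E : Type*} [NormedAddCommGroup E] [NormedSpace ℝ E]
    (A B : Set E) (hA : A.Nonempty) (hB : B.Nonempty)
    (hAc : IsCompact A) (hBc : IsCompact B)
    (f : E →L[ℝ] ℝ) :
    {x | x ∈ A + B ∧ f x = sSup (f '' (A + B))} =
      {x | x ∈ A ∧ f x = sSup (f '' A)} + {x | x ∈ B ∧ f x = sSup (f '' B)} := by
  have bA : BddAbove (f '' A) := (hAc.image f.continuous).bddAbove
  have bB : BddAbove (f '' B) := (hBc.image f.continuous).bddAbove
  have key : sSup (f '' (A + B)) = sSup (f '' A) + sSup (f '' B) := by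
    rw [Set.image_add, csSup_add (hA.image f) bA (hB.image f) bB]
  ext x
  simp only [Set.mem_setOf_eq, Set.mem_add, key]
  constructor
  · rintro ⟨⟨a, ha, b, hb, rfl⟩, h⟩
    have h1 := le_csSup bA (Set.mem_image_of_mem f ha)
    have h2 := le_csSup bB (Set.mem_image_of_mem f hb)
    rw [map_add] at h
    exact ⟨a, ⟨ha, by linarith⟩, b, ⟨hb, by linarith⟩, rfl⟩
  · rintro ⟨a, ⟨ha, h1⟩, b, ⟨hb, h2⟩, rfl⟩
    exact ⟨⟨a, ha, b, hb, rfl⟩, by rw [map_add, h1, h2]⟩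
end

section
/- Let E be a real normed vector space, let Δ ⊆ E be a nonempty compact set, and let v₁, …, v_k be continuous linear functionals on E. Let F = {x ∈ Δ : vᵢ(x) = sup_Δ vᵢ for all i = 1, …, k} be the set of points where the vᵢ attain their joint maximum on Δ, and assume F is nonempty. Then for all positive reals α₁, …, α_k, setting u = α₁v₁ + … + α_k v_k, the set of maximizers of u on Δ equals F: {x ∈ Δ : u(x) = sup_Δ u} = F. -/
/-- Lemma 3.17. Let `Δ` be a nonempty compact subset of a real normed
space and `v₁, …, v_k` continuous linear functionals whose joint-maximum face
`F = {x ∈ Δ : vᵢ(x) = sup_Δ vᵢ ∀ i}` is nonempty. Then for any positive reals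
`α₁, …, α_k`, the set of maximizers on `Δ` of `u = α₁v₁ + … + α_k v_k` equals `F`. -/
theorem joint_face_eq_face_of_positive_combination
    {E : Type*} [NormedAddCommGroup E] [NormedSpace ℝ E]
    (Δ : Set E) (hne : Δ.Nonempty) (hc : IsCompact Δ)
    (k : ℕ) (v : Fin k → (E →L[ℝ] ℝ))
    (hF : {x | x ∈ Δ ∧ ∀ i, v i x = sSup ((v i) '' Δ)}.Nonempty)
    (α : Fin k → ℝ) (hα : ∀ i, 0 < α i) :
    {x | x ∈ Δ ∧ (∑ i, α i * v i x) = sSup ((fun y => ∑ i, α i * v i y) '' Δ)} =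
      {x | x ∈ Δ ∧ ∀ i, v i x = sSup ((v i) '' Δ)} := by
  obtain ⟨z, hz, hzv⟩ := hF
  have hle : ∀ i, ∀ x ∈ Δ, v i x ≤ v i z := by
    intro i x hx
    rw [hzv i]
    exact le_csSup (hc.image (v i).continuous).bddAbove ⟨x, hx, rfl⟩
  have hs : sSup ((fun y => ∑ i, α i * v i y) '' Δ) = ∑ i, α i * v i z := by
    apply IsGreatest.csSup_eq
    refine ⟨⟨z, hz, rfl⟩, ?_⟩
    rintro _ ⟨x, hx, rfl⟩
    exact Finset.sum_le_sum fun i _ => mul_le_mul_of_nonneg_left (hle i x hx) (hα i).le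
  ext x
  simp only [Set.mem_setOf_eq, hs, ← hzv]
  refine and_congr_right fun hx => ⟨fun h i => ?_, fun h => by simp [h]⟩
  have h2 := (Finset.sum_eq_sum_iff_of_le fun i _ =>
    mul_le_mul_of_nonneg_left (hle i x hx) (hα i).le).1 h i (Finset.mem_univ i)
  exact mul_left_cancel₀ (hα i).ne' h2
end

section
/- Work in A = MvPolynomial σ ℝ with S_k its subspace of homogeneous polynomials of total degree k. Let n ≤ m be natural numbers, let I_𝔪 : A → ℝ be linear and vanish on S_k for k ≠ m, let I_𝔫 : A → ℝ be linear and vanish on S_k for k ≠ n, and let J_𝔪, J_𝔫 be the respective kernels of the bilinear forms (x,y) ↦ I_𝔪(xy) and (x,y) ↦ I_𝔫(xy). If J_𝔪 ∩ S_n ⊆ J_𝔫 ∩ S_n, then J_𝔪 ⊆ J_𝔫. (This is Lemma 3.6 of the paper.) -/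
open MvPolynomial in
theorem aux_component {σ : Type*} (d n j : ℕ) (hd : n + j = d) (I : MvPolynomial σ ℝ →ₗ[ℝ] ℝ)
    (hI : ∀ k : ℕ, k ≠ d → ∀ q : MvPolynomial σ ℝ, q.IsHomogeneous k → I q = 0)
    (x w : MvPolynomial σ ℝ) (hw : w.IsHomogeneous j) :
    I (x * w) = I (homogeneousComponent n x * w) := by
  conv_lhs => rw [← sum_homogeneousComponent x, Finset.sum_mul, map_sum]
  apply Finset.sum_eq_single n
  · intro b _ hb
    exact hI (b + j) (by omega) _ ((homogeneousComponent_isHomogeneous b x).mul hw)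
  · intro hn
    rw [homogeneousComponent_eq_zero n x (by simpa using hn)]
    simp

/-- Lemma 3.6. Let `n ≤ m`, let `Im` (resp. `In`) be linear functionals
on `A = MvPolynomial σ ℝ` supported in degree `m` (resp. `n`), with associated kernels
`J_𝔪 = {x : Im(x·y) = 0 ∀ y}` and `J_𝔫 = {x : In(x·y) = 0 ∀ y}`. If
`J_𝔪 ∩ S_n ⊆ J_𝔫 ∩ S_n` (on homogeneous elements of degree `n`), then `J_𝔪 ⊆ J_𝔫`. -/
theorem kernel_inclusion_of_degree_n_inclusion
    (σ : Type*) (n m : ℕ) (hnm : n ≤ m)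
    (Im In : MvPolynomial σ ℝ →ₗ[ℝ] ℝ)
    (hIm : ∀ k : ℕ, k ≠ m → ∀ q : MvPolynomial σ ℝ, q.IsHomogeneous k → Im q = 0)
    (hIn : ∀ k : ℕ, k ≠ n → ∀ q : MvPolynomial σ ℝ, q.IsHomogeneous k → In q = 0)
    (hsub : ∀ x : MvPolynomial σ ℝ, x.IsHomogeneous n →
      (∀ y, Im (x * y) = 0) → (∀ y, In (x * y) = 0)) :
    ∀ x : MvPolynomial σ ℝ, (∀ y, Im (x * y) = 0) → (∀ y, In (x * y) = 0) := by
  intro x hx y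
  have key : ∀ y', Im (MvPolynomial.homogeneousComponent n (x * y) * y') = 0 := by
    intro y'
    rw [← MvPolynomial.sum_homogeneousComponent y', Finset.mul_sum, map_sum]
    apply Finset.sum_eq_zero
    intro j _
    by_cases hj : n + j = m
    · rw [← aux_component m n j hj Im hIm _ _
        (MvPolynomial.homogeneousComponent_isHomogeneous j y'), mul_assoc]
      exact hx _
    · exact hIm (n + j) hj _ ((MvPolynomial.homogeneousComponent_isHomogeneous n _).mul
        (MvPolynomial.homogeneousComponent_isHomogeneous j y'))
  have h1 := hsub _ (MvPolynomial.homogeneousComponent_isHomogeneous n (x * y)) key 1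
  rw [← aux_component n n 0 rfl In hIn _ _ (MvPolynomial.isHomogeneous_one σ ℝ), mul_one] at h1
  exact h1
end

section
/- Let E be a finite-dimensional real inner product space, let 𝔍 be a finite set of proper linear subspaces of E, let r > 0, and let U ⊆ E satisfy B_{𝔍,r} ⊆ U. Let L be a linear subspace of E such that L is not contained in any I ∈ 𝔍. Then U ∩ L is an rf-domain in the inner product space L: there exist a finite set 𝔍' of proper linear subspaces of L and r' > 0 such that {x ∈ L : dist(x, I') ≥ r' for all I' ∈ 𝔍'} ⊆ U ∩ L. (This is Corollary 6.4(3) of the paper; one may take 𝔍' = {I ∩ L : I ∈ 𝔍}.) -/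
/-- A set `U` in a real inner product space `E` is a *domain of relatively full measure*
(rf-domain) if there are a finite set `𝔍` of proper linear subspaces of `E` and `r > 0`
such that `B_{𝔍,r} = {x : dist(x, I) ≥ r ∀ I ∈ 𝔍} ⊆ U`. -/
def IsRfDomain {E : Type*} [NormedAddCommGroup E] [InnerProductSpace ℝ E]
    (U : Set E) : Prop :=
  ∃ (𝔍 : Finset (Submodule ℝ E)) (r : ℝ), 0 < r ∧ (∀ I ∈ 𝔍, I ≠ ⊤) ∧
    {x : E | ∀ I ∈ 𝔍, r ≤ Metric.infDist x (I : Set E)} ⊆ U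

theorem rf_aux {E : Type*} [NormedAddCommGroup E] [InnerProductSpace ℝ E]
    [FiniteDimensional ℝ E] (I L : Submodule ℝ E) :
    ∃ C : ℝ, 0 ≤ C ∧ ∀ x : L, Metric.infDist x ((I.comap L.subtype : Submodule ℝ L) : Set L)
      ≤ C * Metric.infDist (x : E) (I : Set E) := by
  let P : E →L[ℝ] E := (Iᗮ).starProjection
  let f : L →ₗ[ℝ] E := P.toLinearMap ∘ₗ L.subtype
  obtain ⟨g, hg⟩ := f.rangeRestrict.exists_rightInverse_of_surjective f.range_rangeRestrict
  let G := LinearMap.toContinuousLinearMap g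
  refine ⟨‖G‖, G.opNorm_nonneg, fun x => ?_⟩
  have hP : ∀ z : E, P z = 0 ↔ z ∈ I := by
    intro z
    have := (Iᗮ).starProjection_apply_eq_zero_iff (v := z)
    rw [Submodule.orthogonal_orthogonal] at this
    exact this
  set y : L := G (f.rangeRestrict x) with hy
  have hfy : f y = f x := by
    have := congrArg Subtype.val (LinearMap.congr_fun hg (f.rangeRestrict x))
    exact this
  have hmem : x - y ∈ (I.comap L.subtype : Submodule ℝ L) := by
    have h : f (x - y) = 0 := by rw [map_sub, hfy, sub_self]
    exact (hP _).1 h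
  have h1 : Metric.infDist x ((I.comap L.subtype : Submodule ℝ L) : Set L) ≤ ‖G‖ * ‖f x‖ := by
    refine (Metric.infDist_le_dist_of_mem hmem).trans ?_
    rw [dist_eq_norm, sub_sub_cancel]
    exact G.le_opNorm _
  refine h1.trans (mul_le_mul_of_nonneg_left ?_ G.opNorm_nonneg)
  refine (Metric.le_infDist ⟨0, I.zero_mem⟩).2 fun {z} hz => ?_
  have h2 : f x = P ((x : E) - z) := by
    rw [map_sub, (hP z).2 hz, sub_zero]; rfl
  rw [h2, dist_eq_norm]
  exact (Iᗮ).norm_starProjection_apply_le _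

/-- Corollary 6.4(3). If `B_{𝔍,r} ⊆ U` and `L` is a subspace of `E`
not contained in any of the subspaces of `𝔍`, then `U ∩ L` is an rf-domain of the inner
product space `L`. -/
theorem isRfDomain_inter_subspace
    {E : Type*} [NormedAddCommGroup E] [InnerProductSpace ℝ E] [FiniteDimensional ℝ E]
    (𝔍 : Finset (Submodule ℝ E)) (r : ℝ) (hr : 0 < r) (hproper : ∀ I ∈ 𝔍, I ≠ ⊤)
    (U : Set E)
    (hU : {x : E | ∀ I ∈ 𝔍, r ≤ Metric.infDist x (I : Set E)} ⊆ U)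
    (L : Submodule ℝ E) (hL : ∀ I ∈ 𝔍, ¬ L ≤ I) :
    IsRfDomain {x : L | (x : E) ∈ U} := by
  classical
  choose C hC0 hC using fun I : Submodule ℝ E => rf_aux I L
  have hs : 0 ≤ ∑ I ∈ 𝔍, C I := Finset.sum_nonneg fun I _ => hC0 I
  refine ⟨𝔍.image fun I => I.comap L.subtype, (1 + ∑ I ∈ 𝔍, C I) * r, by positivity, ?_, ?_⟩
  · intro J hJ
    obtain ⟨I, hI, rfl⟩ := Finset.mem_image.1 hJ
    intro h
    exact hL I hI (Submodule.comap_subtype_eq_top.1 h)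
  · intro x hx
    refine hU fun I hI => ?_
    have h1 := (hx _ (Finset.mem_image_of_mem _ hI)).trans (hC I x)
    have h2 : C I ≤ ∑ I ∈ 𝔍, C I := Finset.single_le_sum (fun I _ => hC0 I) hI
    by_contra! h
    have h3 := mul_le_mul_of_nonneg_left h.le (hC0 I)
    have h4 := mul_le_mul_of_nonneg_right h2 hr.le
    linarith
end

section
/- Let E be a finite-dimensional real inner product space and let T : E → E be a linear automorphism. If U ⊆ E is an rf-domain, then T(U) is an rf-domain. (This expresses Corollary 6.4(2) of the paper: the property of being an rf-domain does not depend on the choice of metric on E, since a change of inner product amounts to pulling the distance functions back by a linear automorphism.) -/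
/-- Corollary 6.4(2). The image of an rf-domain under a linear
automorphism of `E` is again an rf-domain: the notion of rf-domain does not depend on
the choice of metric on `E`. -/
theorem isRfDomain_image_linearEquiv
    {E : Type*} [NormedAddCommGroup E] [InnerProductSpace ℝ E] [FiniteDimensional ℝ E]
    (T : E ≃ₗ[ℝ] E) (U : Set E) (hU : IsRfDomain U) :
    IsRfDomain (T '' U) := by
  classical
  obtain ⟨J, r, hr, hJ, hsub⟩ := hU
  let L : E →L[ℝ] E := LinearMap.toContinuousLinearMap T.toLinearMap
  have hL : ∀ x, L x = T x := fun x => rfl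
  have hC : 0 < ‖L‖ + 1 := by positivity
  refine ⟨J.image (fun I => I.map T.toLinearMap), (‖L‖ + 1) * r, by positivity, ?_, ?_⟩
  · intro I' hI'
    obtain ⟨I, hI, rfl⟩ := Finset.mem_image.1 hI'
    intro h
    apply hJ I hI
    rw [eq_top_iff]
    intro x _
    have hx : T x ∈ I.map T.toLinearMap := by rw [h]; trivial
    obtain ⟨z, hz, hzx⟩ := Submodule.mem_map.1 hx
    have hzx' : z = x := T.injective hzx
    exact hzx' ▸ hz
  · intro y hy
    refine ⟨T.symm y, hsub ?_, T.apply_symm_apply y⟩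
    intro I hI
    have h1 := hy _ (Finset.mem_image_of_mem _ hI)
    refine (Metric.le_infDist ⟨0, I.zero_mem⟩).2 ?_
    intro z hz
    have h2 : Metric.infDist y (I.map T.toLinearMap : Set E) ≤ dist y (T z) :=
      Metric.infDist_le_dist_of_mem (Submodule.mem_map_of_mem hz)
    have h3 : dist y (T z) ≤ ‖L‖ * dist (T.symm y) z := by
      have h4 := L.le_opNorm (T.symm y - z)
      rw [hL, map_sub, T.apply_symm_apply] at h4
      rw [dist_eq_norm, dist_eq_norm]
      exact h4
    have h5 : 0 ≤ dist (T.symm y) z := dist_nonneg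
    refine le_of_mul_le_mul_left ?_ hC
    have h6 := h1.trans (h2.trans h3)
    linarith
end
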